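/- arXiv:1408.1585 — 3 statements merged into one kernel-verified Lean document; each statement's English description precedes it below -/
import Mathlib

section
/- Let 𝕀 = (I, ≤, 𝓘) be a set of indices and let b : I → ℝ with b_ε > 0 for all ε ∈ I and lim_𝕀 b = +∞. Then there exists a net (ψ_ε)_{ε∈I} of smooth compactly supported functions ψ_ε : ℝⁿ → ℝ such that: (1) supp(ψ_ε) is contained in the closed unit ball B_1(0) for all ε ∈ I; (2) ∫_{ℝⁿ} ψ_ε = 1 for all ε ∈ I; (3) for every multi-index α ∈ ℕⁿ there exists p ∈ ℕ such that (sup_{x∈ℝⁿ} |∂^α ψ_ε(x)|)_ε = O((b_ε^p)_ε); (4) for every j ∈ ℕ, for ε sufficiently small in 𝕀 it holds that ∫_{ℝⁿ} x^α·ψ_ε(x) dx = 0 for all multi-indices α with 1 ≤ |α| ≤ j; (5) for every η > 0, for ε sufficiently small in 𝕀 it holds that ∫_{ℝⁿ} |ψ_ε| ≤ 1 + η. -/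
open MeasureTheory

/-- Strict order relation used in the paper: `x < y` iff `x ≤ y` and `x ≠ y`. -/
def sLT {I : Type*} [Preorder I] (x y : I) : Prop := x ≤ y ∧ x ≠ y

/-- A set of indices `𝕀 = (I, ≤, 𝓘)` in the sense of Giordano–Luperi Baglini. -/
structure SetOfIndices (I : Type*) [Preorder I] where
  sets : Set (Set I)
  empty_not_mem : (∅ : Set I) ∉ sets
  univ_mem : (Set.univ : Set I) ∈ sets
  inter_sub : ∀ A ∈ sets, ∀ B ∈ sets, ∃ C ∈ sets, C ⊆ A ∩ B
  downward : ∀ A ∈ sets, ∀ a ∈ A, ∀ e, e ≤ a →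
    ((∃ ε, ε ∈ A ∧ ε ≤ e) ∧
      (∀ b ∈ A, b ≤ e → ∀ c ∈ A, c ≤ e →
        ∃ d, d ∈ A ∧ d ≤ e ∧ sLT d b ∧ sLT d c))

section Defs

variable {I : Type*} [Preorder I]

/-- `x = O_{a,A}(y)`. -/
def BigOaA (A : Set I) (a : I) (x y : I → ℝ) : Prop :=
  ∃ H : ℝ, 0 < H ∧ ∃ ε₀, ε₀ ∈ A ∧ ε₀ ≤ a ∧ ∀ ε ∈ A, ε ≤ ε₀ → |x ε| ≤ H * |y ε|

/-- `x = O_𝒥(y)` for a family `𝒥` of subsets of `I`. -/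
def BigOJ (J : Set (Set I)) (x y : I → ℝ) : Prop :=
  ∃ A ∈ J, ∀ a ∈ A, BigOaA A a x y

/-- `x = O(y)` (i.e. `O_𝓘`). -/
def BigO (S : SetOfIndices I) (x y : I → ℝ) : Prop := BigOJ S.sets x y

/-- `i >_𝕀 j`. -/
def gtI (S : SetOfIndices I) (i j : I → ℝ) : Prop :=
  ∃ A ∈ S.sets, ∀ a ∈ A, ∃ e, e ∈ A ∧ e ≤ a ∧ ∀ ε ∈ A, ε ≤ e → j ε < i ε

/-- `P(ε)` holds for `ε` sufficiently small in `𝕀`. -/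
def EventuallyI (S : SetOfIndices I) (P : I → Prop) : Prop :=
  ∃ A ∈ S.sets, ∀ a ∈ A, ∃ e, e ∈ A ∧ e ≤ a ∧ ∀ ε ∈ A, ε ≤ e → P ε

/-- `lim_𝕀 f = l` for a finite limit `l ∈ ℝ`. -/
def limEq (S : SetOfIndices I) (f : I → ℝ) (l : ℝ) : Prop :=
  ∃ A ∈ S.sets, ∀ a ∈ A, ∀ r : ℝ, 0 < r →
    ∃ a₀, a₀ ≤ a ∧ ∀ ε ∈ A, ε ≤ a₀ → |l - f ε| < r

/-- `lim_𝕀 f = ∞` (unsigned infinity). -/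
def limInfinite (S : SetOfIndices I) (f : I → ℝ) : Prop :=
  ∃ A ∈ S.sets, ∀ a ∈ A, ∀ R : ℝ, 0 < R →
    ∃ a₀, a₀ ≤ a ∧ ∀ ε ∈ A, ε ≤ a₀ → R < |f ε|

/-- `lim_𝕀 f = +∞`. -/
def limPInf (S : SetOfIndices I) (f : I → ℝ) : Prop :=
  ∃ A ∈ S.sets, ∀ a ∈ A, ∀ R : ℝ, 0 < R →
    ∃ a₀, a₀ ≤ a ∧ ∀ ε ∈ A, ε ≤ a₀ → R < f ε

/-- `𝓑` is an asymptotic gauge on the set of indices `S`. -/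
structure IsAG (S : SetOfIndices I) (B : Set (I → ℝ)) : Prop where
  infinite : ∃ i ∈ B, limInfinite S i
  mul : ∀ i ∈ B, ∀ j ∈ B, ∃ p ∈ B, BigO S (fun ε => i ε * j ε) p
  smul : ∀ i ∈ B, ∀ r : ℝ, ∃ σ ∈ B, BigO S (fun ε => r * i ε) σ
  absAdd : ∀ i ∈ B, ∀ j ∈ B, ∃ s ∈ B, gtI S s (fun _ => 0) ∧
    BigO S (fun ε => |i ε| + |j ε|) s

/-- `𝓑_{>0}`, the positive part of `𝓑`. -/
def agPos (S : SetOfIndices I) (B : Set (I → ℝ)) : Set (I → ℝ) :=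
  {i ∈ B | gtI S i (fun _ => 0)}

/-- `ℝ_M(𝓑)`, the moderate nets generated by `𝓑`. -/
def RM (S : SetOfIndices I) (B : Set (I → ℝ)) : Set (I → ℝ) :=
  {x | ∃ b ∈ B, BigO S x b}

/-- `sup_{x ∈ K} |f x|`. -/
noncomputable def supAbsOn {X : Type*} (K : Set X) (f : X → ℝ) : ℝ :=
  sSup ((fun x => |f x|) '' K)

/-- Partial derivative of `f : ℝⁿ → ℝ` in the `i`-th coordinate direction. -/
noncomputable def pDeriv {n : ℕ} (i : Fin n) (f : (Fin n → ℝ) → ℝ) :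
    (Fin n → ℝ) → ℝ :=
  fun x => fderiv ℝ f x (Pi.single i 1)

/-- Iterated partial derivative `∂^α f` along a list of coordinate directions
(the list encodes the multi-index `α ∈ ℕⁿ`). -/
noncomputable def multiDeriv {n : ℕ} : List (Fin n) → ((Fin n → ℝ) → ℝ) → ((Fin n → ℝ) → ℝ)
  | [], f => f
  | i :: l, f => multiDeriv l (pDeriv i f)

/-- `ℰ_M(𝓑,Ω)`: the `𝓑`-moderate nets of smooth functions on `Ω ⊆ ℝⁿ`. -/
def EMod (S : SetOfIndices I) (B : Set (I → ℝ)) {n : ℕ} (Ω : Set (Fin n → ℝ))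
    (u : I → (Fin n → ℝ) → ℝ) : Prop :=
  ∀ K : Set (Fin n → ℝ), K ⊆ Ω → IsCompact K → ∀ l : List (Fin n),
    ∃ b ∈ B, BigO S (fun ε => supAbsOn K (multiDeriv l (u ε))) b

/-- `𝒩(𝒵,Ω)`: the `𝒵`-negligible nets of smooth functions on `Ω ⊆ ℝⁿ`. -/
def NNeg (S : SetOfIndices I) (Z : Set (I → ℝ)) {n : ℕ} (Ω : Set (Fin n → ℝ))
    (u : I → (Fin n → ℝ) → ℝ) : Prop :=
  ∀ K : Set (Fin n → ℝ), K ⊆ Ω → IsCompact K → ∀ l : List (Fin n),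
    ∀ z ∈ agPos S Z,
      BigO S (fun ε => supAbsOn K (multiDeriv l (u ε))) (fun ε => (z ε)⁻¹)

/-- One–dimensional version of `ℰ_M(𝓑,ℝ)`, using iterated derivatives. -/
def EM1 (S : SetOfIndices I) (B : Set (I → ℝ)) (u : I → ℝ → ℝ) : Prop :=
  ∀ K : Set ℝ, IsCompact K → ∀ k : ℕ,
    ∃ b ∈ B, BigO S (fun ε => supAbsOn K (iteratedDeriv k (u ε))) b

/-- One–dimensional version of `𝒩(𝒵,ℝ)`, using iterated derivatives. -/
def NEG1 (S : SetOfIndices I) (Z : Set (I → ℝ)) (u : I → ℝ → ℝ) : Prop :=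
  ∀ K : Set ℝ, IsCompact K → ∀ k : ℕ, ∀ z ∈ agPos S Z,
    BigO S (fun ε => supAbsOn K (iteratedDeriv k (u ε))) (fun ε => (z ε)⁻¹)

/-- `AG(b) = {b^m ∣ m ∈ ℕ}`, the principal asymptotic gauge generated by `b`. -/
def AGpow (b : I → ℝ) : Set (I → ℝ) := {g | ∃ m : ℕ, g = fun ε => (b ε) ^ m}

/-- `e^𝓑 = {e^{H·b} ∣ H > 0, b ∈ 𝓑}`, the exponential of the asymptotic gauge `𝓑`. -/
def expAG (B : Set (I → ℝ)) : Set (I → ℝ) :=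
  {g | ∃ H : ℝ, 0 < H ∧ ∃ b ∈ B, g = fun ε => Real.exp (H * b ε)}

end Defs

/-- `φ` is a test function supported in the closed unit ball, of unit integral, whose moments of
orders `1, …, k` vanish and whose `L¹`-norm is at most `1 + δ`. -/
structure IsMomentMollifier {n : ℕ} (k : ℕ) (δ : ℝ) (φ : (Fin n → ℝ) → ℝ) : Prop where
  contDiff : ContDiff ℝ (⊤ : ℕ∞) φ
  tsupport_subset : tsupport φ ⊆ Metric.closedBall 0 1
  integral_eq_one : ∫ x, φ x = 1
  moment_eq_zero : ∀ α : Fin n → ℕ, 1 ≤ ∑ i, α i → ∑ i, α i ≤ k →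
    ∫ x, (∏ i, (x i) ^ (α i)) * φ x = 0
  integral_abs_le : ∫ x, |φ x| ≤ 1 + δ

namespace IsMomentMollifier

variable {n k : ℕ} {δ : ℝ} {φ : (Fin n → ℝ) → ℝ}

theorem hasCompactSupport (h : IsMomentMollifier k δ φ) : HasCompactSupport φ :=
  HasCompactSupport.of_support_subset_isCompact (isCompact_closedBall 0 1)
    ((subset_tsupport φ).trans h.tsupport_subset)

/-- A suitable combination of `φ` with one of its contractions has one more vanishing moment,
at an arbitrarily small cost in `L¹`-norm. -/
theorem exists_succ (hδ : 0 < δ) (h : IsMomentMollifier k (δ / 2) φ) :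
    ∃ θ : (Fin n → ℝ) → ℝ, IsMomentMollifier (k + 1) δ θ := by
  obtain ⟨c, hc⟩ : ∃ c : ℝ, c = 4 / δ + 3 := ⟨_, rfl⟩
  have hc3 : 3 < c := by rw [hc]; linarith [div_pos (by norm_num : (0 : ℝ) < 4) hδ]
  have hc0 : 0 < c := by linarith
  obtain ⟨s, hs⟩ : ∃ s : ℝ, s = (c ^ (k + 1))⁻¹ := ⟨_, rfl⟩
  have hs0 : 0 < s := by rw [hs]; positivity
  have hsc : s * c ≤ 1 := by
    have : c ≤ c ^ (k + 1) := le_self_pow₀ (by linarith) (by omega)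
    rw [hs, inv_mul_le_iff₀ (by positivity)]
    linarith
  have hs1 : s < 1 := by nlinarith
  have hsδ : s * (4 + 3 * δ) ≤ δ := by
    have : c * δ = 4 + 3 * δ := by rw [hc]; field_simp
    nlinarith
  have h1s : (1 - s) ≠ 0 := by linarith
  have scale (f : (Fin n → ℝ) → ℝ) : c ^ n * ∫ x, f (c • x) = ∫ x, f x := by
    rw [Measure.integral_comp_smul]
    simp only [Module.finrank_fintype_fun_eq_card, Fintype.card_fin, smul_eq_mul]
    rw [abs_of_pos (by positivity), ← mul_assoc, mul_inv_cancel₀ (by positivity), one_mul]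
  have hcont := h.contDiff.continuous
  have smul_integrable {f : (Fin n → ℝ) → ℝ} (hf : Integrable f) :
      Integrable fun x => c ^ n * f (c • x) := (hf.comp_smul hc0.ne').const_mul _
  have hφint : Integrable φ := hcont.integrable_of_hasCompactSupport h.hasCompactSupport
  let θ : (Fin n → ℝ) → ℝ := fun x => (1 - s)⁻¹ * (c ^ n * φ (c • x)) - s * (1 - s)⁻¹ * φ x
  have hθ : ContDiff ℝ (⊤ : ℕ∞) θ :=
    (contDiff_const.mul (contDiff_const.mul (h.contDiff.comp (contDiff_const_smul c)))).sub
      (contDiff_const.mul h.contDiff)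
  have hθsupp : tsupport θ ⊆ Metric.closedBall 0 1 := by
    refine closure_minimal (fun x hx => ?_) Metric.isClosed_closedBall
    by_contra hx1
    have hzero {y : Fin n → ℝ} (hy : y ∉ Metric.closedBall 0 1) : φ y = 0 :=
      image_eq_zero_of_notMem_tsupport fun hy' => hy (h.tsupport_subset hy')
    have hcx : c • x ∉ Metric.closedBall (0 : Fin n → ℝ) 1 := by
      rw [mem_closedBall_zero_iff, not_le] at hx1 ⊢
      rw [norm_smul, Real.norm_of_nonneg hc0.le]
      nlinarith
    exact hx (by simp [θ, hzero hx1, hzero hcx])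
  have hθint : Integrable θ := ((smul_integrable hφint).const_mul _).sub (hφint.const_mul _)
  refine ⟨θ, hθ, hθsupp, ?_, fun α h1 hk => ?_, ?_⟩
  · rw [integral_sub ((smul_integrable hφint).const_mul _) (hφint.const_mul _),
      integral_const_mul, integral_const_mul, integral_const_mul, scale, h.integral_eq_one]
    field_simp
  · have hmint : Integrable fun x : Fin n → ℝ => (∏ i, (x i) ^ (α i)) * φ x :=
      ((by fun_prop : Continuous fun x : Fin n → ℝ => ∏ i, (x i) ^ (α i)).mul
        hcont).integrable_of_hasCompactSupport h.hasCompactSupport.mul_left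
    have key : (fun x : Fin n → ℝ => (∏ i, (x i) ^ (α i)) * θ x) = fun x =>
        ((1 - s)⁻¹ * (c ^ ∑ i, α i)⁻¹) *
          (c ^ n * ((∏ i, ((c • x) i) ^ (α i)) * φ (c • x))) -
        s * (1 - s)⁻¹ * ((∏ i, (x i) ^ (α i)) * φ x) := by
      funext x
      have : ∏ i, ((c • x) i) ^ (α i) = c ^ (∑ i, α i) * ∏ i, (x i) ^ (α i) := by
        simp [mul_pow, Finset.prod_mul_distrib, Finset.prod_pow_eq_pow_sum]
      have hne : c ^ (∑ i, α i) ≠ 0 := by positivity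
      simp only [θ, this]
      field_simp
    rw [key, integral_sub ((smul_integrable hmint).const_mul _) (hmint.const_mul _),
      integral_const_mul, integral_const_mul, integral_const_mul,
      scale fun x : Fin n → ℝ => (∏ i, (x i) ^ (α i)) * φ x]
    rcases hk.lt_or_eq with hlt | heq
    · rw [h.moment_eq_zero α h1 (by omega)]
      ring
    · rw [heq, ← hs]
      ring
  · have habs := smul_integrable hφint.abs
    calc ∫ x, |θ x|
        ≤ ∫ x, ((1 - s)⁻¹ * (c ^ n * |φ (c • x)|) + s * (1 - s)⁻¹ * |φ x|) := by
          refine integral_mono hθint.abs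
            ((habs.const_mul _).add (hφint.abs.const_mul _)) fun x => ?_
          have h1 : 0 < (1 - s)⁻¹ := inv_pos.2 (by linarith)
          refine (abs_sub _ _).trans_eq ?_
          simp only [abs_mul, abs_of_pos h1, abs_of_pos hs0, abs_of_pos (pow_pos hc0 n)]
      _ = (1 - s)⁻¹ * (1 + s) * ∫ x, |φ x| := by
          rw [integral_add (habs.const_mul _) (hφint.abs.const_mul _), integral_const_mul,
            integral_const_mul, integral_const_mul, scale fun x => |φ x|]
          ring
      _ ≤ (1 - s)⁻¹ * (1 + s) * (1 + δ / 2) := by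
          have : 0 < (1 - s)⁻¹ := inv_pos.2 (by linarith)
          gcongr
          exact h.integral_abs_le
      _ ≤ 1 + δ := by
          rw [mul_assoc, inv_mul_le_iff₀ (by linarith)]
          nlinarith

end IsMomentMollifier

theorem exists_isMomentMollifier (n k : ℕ) {δ : ℝ} (hδ : 0 < δ) :
    ∃ φ : (Fin n → ℝ) → ℝ, IsMomentMollifier k δ φ := by
  induction k generalizing δ with
  | zero =>
    let f : ContDiffBump (0 : Fin n → ℝ) := ⟨1 / 2, 1, by norm_num, by norm_num⟩
    refine ⟨f.normed volume, f.contDiff_normed, f.tsupport_normed_eq.subset,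
      f.integral_normed, fun α h1 h0 => by omega, ?_⟩
    simp only [abs_of_nonneg (f.nonneg_normed _), f.integral_normed]
    linarith
  | succ k ih =>
    obtain ⟨φ, hφ⟩ := ih (half_pos hδ)
    exact hφ.exists_succ hδ

theorem exists_abs_multiDeriv_le {n : ℕ} (l : List (Fin n)) {f : (Fin n → ℝ) → ℝ}
    (hf : ContDiff ℝ (⊤ : ℕ∞) f) (hs : HasCompactSupport f) :
    ∃ C, ∀ x, |multiDeriv l f x| ≤ C := by
  induction l generalizing f with
  | nil => exact hs.exists_bound_of_continuous hf.continuous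
  | cons i l ih =>
    exact ih ((hf.fderiv_right (m := (⊤ : ℕ∞)) (by simp)).clm_apply contDiff_const)
      (hs.fderiv_apply ℝ _)

theorem exists_abs_multiDeriv_le_of_length_le {n : ℕ} (k : ℕ) {f : (Fin n → ℝ) → ℝ}
    (hf : ContDiff ℝ (⊤ : ℕ∞) f) (hs : HasCompactSupport f) :
    ∃ C, ∀ l : List (Fin n), l.length ≤ k → ∀ x, |multiDeriv l f x| ≤ C := by
  choose C hC using fun l : List (Fin n) => exists_abs_multiDeriv_le l hf hs
  obtain ⟨M, hM⟩ := ((List.finite_length_le (Fin n) k).image C).bddAbove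
  exact ⟨M, fun l hl x => (hC l x).trans (hM ⟨l, hl, rfl⟩)⟩

/-- A net tending to infinity exceeds every real number on a common set of indices. -/
theorem limPInf.exists_mem_forall_lt {I : Type*} [Preorder I] {S : SetOfIndices I} {b : I → ℝ}
    (hb : limPInf S b) :
    ∃ A ∈ S.sets, ∀ R : ℝ, ∀ a ∈ A, ∃ e, e ∈ A ∧ e ≤ a ∧ ∀ ε ∈ A, ε ≤ e → R < b ε := by
  obtain ⟨A, hA, h⟩ := hb
  refine ⟨A, hA, fun R a ha => ?_⟩
  obtain ⟨a₀, ha₀, hR⟩ := h a ha (max R 1) (by positivity)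
  obtain ⟨⟨e, heA, he⟩, -⟩ := S.downward A hA a ha a₀ ha₀
  exact ⟨e, heA, he.trans ha₀, fun ε hε hle =>
    (le_max_left _ _).trans_lt (hR ε hε (hle.trans he))⟩

theorem limPInf.eventuallyI {I : Type*} [Preorder I] {S : SetOfIndices I} {b : I → ℝ}
    (hb : limPInf S b) {P : I → Prop} (R : ℝ) (hP : ∀ ε, R < b ε → P ε) : EventuallyI S P := by
  obtain ⟨A, hA, h⟩ := hb.exists_mem_forall_lt
  refine ⟨A, hA, fun a ha => ?_⟩
  obtain ⟨e, heA, hea, he⟩ := h R a ha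
  exact ⟨e, heA, hea, fun ε hε hle => hP ε (he ε hε hle)⟩

theorem EventuallyI.bigO {I : Type*} [Preorder I] {S : SetOfIndices I} {x y : I → ℝ}
    (h : EventuallyI S fun ε => |x ε| ≤ |y ε|) : BigO S x y := by
  obtain ⟨A, hA, h⟩ := h
  refine ⟨A, hA, fun a ha => ⟨1, one_pos, ?_⟩⟩
  simpa only [one_mul] using h a ha

/-- For every sequence `C` of reals there are indices `k t` tending to infinity with `t`
along which `C` is eventually bounded by `t`. -/
theorem exists_index_le (C : ℕ → ℝ) :
    ∃ k : ℝ → ℕ, ∀ K : ℕ, ∃ R : ℝ, ∀ t, R < t → K ≤ k t ∧ C (k t) ≤ t := by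
  classical
  refine ⟨fun t => Nat.findGreatest (fun m => C m ≤ t) ⌊t⌋₊,
    fun K => ⟨max K (C K), fun t ht => ?_⟩⟩
  obtain ⟨hK, hC⟩ := max_lt_iff.1 ht
  have hfl : K ≤ ⌊t⌋₊ := Nat.le_floor hK.le
  exact ⟨Nat.le_findGreatest hfl hC.le,
    Nat.findGreatest_spec (P := fun m => C m ≤ t) hfl hC.le⟩


/-- existence of a strict delta-net associated with a generator `b`
(Thm. `strictDeltaNet` of the paper). -/
theorem strict_delta_net {I : Type*} [Preorder I] (S : SetOfIndices I) (n : ℕ)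
    (b : I → ℝ) (hbpos : ∀ ε, 0 < b ε) (hb : limPInf S b) :
    ∃ ψ : I → (Fin n → ℝ) → ℝ,
      (∀ ε, ContDiff ℝ (⊤ : ℕ∞) (ψ ε)) ∧
      (∀ ε, tsupport (ψ ε) ⊆ Metric.closedBall 0 1) ∧
      (∀ ε, ∫ x, ψ ε x = 1) ∧
      (∀ l : List (Fin n), ∃ p : ℕ,
        BigO S (fun ε => supAbsOn Set.univ (multiDeriv l (ψ ε)))
          (fun ε => (b ε) ^ p)) ∧
      (∀ j : ℕ, EventuallyI S (fun ε => ∀ α : Fin n → ℕ,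
        1 ≤ ∑ i, α i → ∑ i, α i ≤ j →
          ∫ x, (∏ i, (x i) ^ (α i)) * ψ ε x = 0)) ∧
      (∀ η : ℝ, 0 < η → EventuallyI S (fun ε => ∫ x, |ψ ε x| ≤ 1 + η)) := by
  choose φ hφ using fun k : ℕ =>
    exists_isMomentMollifier n k (Nat.one_div_pos_of_nat (α := ℝ) (n := k))
  choose C hC using fun k : ℕ =>
    exists_abs_multiDeriv_le_of_length_le k (hφ k).contDiff (hφ k).hasCompactSupport
  obtain ⟨k, hk⟩ := exists_index_le C
  refine ⟨fun ε => φ (k (b ε)), fun ε => (hφ _).contDiff, fun ε => (hφ _).tsupport_subset,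
    fun ε => (hφ _).integral_eq_one, fun l => ⟨1, EventuallyI.bigO ?_⟩, fun j => ?_,
    fun η hη => ?_⟩
  · obtain ⟨R, hR⟩ := hk l.length
    refine hb.eventuallyI R fun ε hε => ?_
    obtain ⟨hlen, hCb⟩ := hR _ hε
    have hnonneg : 0 ≤ supAbsOn Set.univ (multiDeriv l (φ (k (b ε)))) :=
      Real.sSup_nonneg (by rintro _ ⟨x, -, rfl⟩; exact abs_nonneg _)
    rw [abs_of_nonneg hnonneg, pow_one, abs_of_pos (hbpos ε)]
    refine csSup_le (Set.univ_nonempty.image _) ?_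
    rintro _ ⟨x, -, rfl⟩
    exact (hC _ l hlen x).trans hCb
  · obtain ⟨R, hR⟩ := hk j
    exact hb.eventuallyI R fun ε hε α h1 hj =>
      (hφ _).moment_eq_zero α h1 (hj.trans (hR _ hε).1)
  · obtain ⟨K, hK⟩ := exists_nat_one_div_lt hη
    obtain ⟨R, hR⟩ := hk K
    refine hb.eventuallyI R fun ε hε => (hφ _).integral_abs_le.trans ?_
    have := Nat.one_div_le_one_div (α := ℝ) (hR _ hε).1
    linarith
end

section
/- Let 𝕀 = (I, ≤, 𝓘) be a set of indices and let 𝓑, 𝓑', 𝒵' be asymptotic gauges on 𝕀 with ℝ_M(e^𝓑) ⊆ ℝ_M(𝓑') ⊆ ℝ_M(𝒵'), where e^𝓑 := {(exp(H·b_ε))_ε | H > 0, b ∈ 𝓑}. Let d ≥ 1, t₀ ∈ ℝ, and let (A_ε)_{ε∈I} be a net of d×d real matrices each of whose entry nets belongs to ℝ_M(𝓑). Suppose (x_ε)_{ε∈I} is a net of smooth functions ℝ → ℝ^d whose component nets belong to ℰ_M(𝓑',ℝ), (n_ε)_{ε∈I} is a net of smooth functions ℝ → ℝ^d whose component nets belong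 to 𝒩(𝒵',ℝ), and (v_ε)_{ε∈I} is a net of vectors in ℝ^d each of whose component nets is 𝒵'-negligible (i.e. for every z ∈ 𝒵'_{>0}, ((v_ε)_i)_ε = O((z_ε^{-1})_ε)), and that for every ε ∈ I: x_ε'(t) + A_ε·x_ε(t) = n_ε(t) for all t ∈ ℝ, and x_ε(t₀) = v_ε. Then each component net of (x_ε) belongs to 𝒩(𝒵',ℝ). -/
open MeasureTheory

section Asymptotics

open Filter Topology

variable {I : Type*} [Preorder I] {S : SetOfIndices I}

/-- The filter generated by the sections `{ε ∈ A | ε ≤ e}` with `e ∈ A` and `e ≤ a`. -/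
def smallFilter (A : Set I) (a : I) : Filter I :=
  ⨅ e ∈ {e | e ∈ A ∧ e ≤ a}, 𝓟 {ε | ε ∈ A ∧ ε ≤ e}

theorem hasBasis_smallFilter {A : Set I} (hA : A ∈ S.sets) {a : I} (ha : a ∈ A) :
    (smallFilter A a).HasBasis (fun e => e ∈ A ∧ e ≤ a) (fun e => {ε | ε ∈ A ∧ ε ≤ e}) := by
  refine hasBasis_biInf_principal ?_ ⟨a, ha, le_rfl⟩
  rintro b ⟨hb, hba⟩ c ⟨hc, hca⟩
  obtain ⟨e, he, hea, hb', hc'⟩ := (S.downward A hA a ha a le_rfl).2 b hb hba c hc hca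
  exact ⟨e, ⟨he, hea⟩, fun ε hε => ⟨hε.1, hε.2.trans hb'.1⟩, fun ε hε => ⟨hε.1, hε.2.trans hc'.1⟩⟩

theorem smallFilter_mono {A C : Set I} (hA : A ∈ S.sets) (hC : C ∈ S.sets) (hCA : C ⊆ A)
    {c : I} (hc : c ∈ C) : smallFilter C c ≤ smallFilter A c := by
  refine ((hasBasis_smallFilter hC hc).le_basis_iff (hasBasis_smallFilter hA (hCA hc))).2 ?_
  rintro e ⟨-, hec⟩
  obtain ⟨e', he', hee'⟩ := (S.downward C hC c hc e hec).1
  exact ⟨e', ⟨he', hee'.trans hec⟩, fun ε hε => ⟨hCA hε.1, hε.2.trans hee'⟩⟩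

/-- Some member of `𝓘` has all of its filters of small indices satisfying `P`. -/
def ForSmall (S : SetOfIndices I) (P : Filter I → Prop) : Prop :=
  ∃ A ∈ S.sets, ∀ a ∈ A, P (smallFilter A a)

theorem ForSmall.mono {P Q : Filter I → Prop} (h : ForSmall S P) (hPQ : ∀ F, P F → Q F) :
    ForSmall S Q := by
  obtain ⟨A, hA, h⟩ := h
  exact ⟨A, hA, fun a ha => hPQ _ (h a ha)⟩

theorem ForSmall.and {P Q : Filter I → Prop} (hP : ForSmall S P) (hQ : ForSmall S Q)
    (hPa : Antitone P) (hQa : Antitone Q) : ForSmall S (fun F => P F ∧ Q F) := by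
  obtain ⟨A, hA, hP⟩ := hP
  obtain ⟨B, hB, hQ⟩ := hQ
  obtain ⟨C, hC, hCAB⟩ := S.inter_sub A hA B hB
  obtain ⟨hCA, hCB⟩ := Set.subset_inter_iff.1 hCAB
  exact ⟨C, hC, fun c hc => ⟨hPa (smallFilter_mono hA hC hCA hc) (hP c (hCA hc)),
    hQa (smallFilter_mono hB hC hCB hc) (hQ c (hCB hc))⟩⟩

theorem antitone_isBigO {J : Type*} (f g : J → ℝ) : Antitone (fun F : Filter J => f =O[F] g) :=
  fun _ _ h hO => hO.mono h

theorem antitone_eventually {J : Type*} (p : J → Prop) :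
    Antitone (fun F : Filter J => ∀ᶠ ε in F, p ε) :=
  fun _ _ h hp => hp.filter_mono h

theorem bigO_iff_forSmall {f g : I → ℝ} : BigO S f g ↔ ForSmall S (fun F => f =O[F] g) := by
  refine exists_congr fun A => and_congr_right fun hA => forall₂_congr fun a ha => ?_
  beta_reduce
  rw [Asymptotics.isBigO_iff']
  refine exists_congr fun H => and_congr_right fun _ => ?_
  rw [(hasBasis_smallFilter hA ha).eventually_iff]
  simp only [Set.mem_ofPred_eq, and_assoc, and_imp, Real.norm_eq_abs]

theorem gtI_iff_forSmall {f g : I → ℝ} :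
    gtI S f g ↔ ForSmall S (fun F => ∀ᶠ ε in F, g ε < f ε) := by
  refine exists_congr fun A => and_congr_right fun hA => forall₂_congr fun a ha => ?_
  beta_reduce
  rw [(hasBasis_smallFilter hA ha).eventually_iff]
  simp only [Set.mem_ofPred_eq, and_assoc, and_imp]

theorem limInfinite.forSmall_tendsto {f : I → ℝ} (h : limInfinite S f) :
    ForSmall S (fun F => Tendsto (fun ε => |f ε|) F atTop) := by
  obtain ⟨A, hA, h⟩ := h
  refine ⟨A, hA, fun a ha => tendsto_atTop.2 fun R => ?_⟩
  obtain ⟨a₀, ha₀, hR⟩ := h a ha (max R 1) (by positivity)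
  obtain ⟨e, he, hea₀⟩ := (S.downward A hA a ha a₀ ha₀).1
  exact (hasBasis_smallFilter hA ha).mem_iff.2 ⟨e, ⟨he, hea₀.trans ha₀⟩, fun ε hε =>
    (le_max_left R 1).trans (hR ε hε.1 (hε.2.trans hea₀)).le⟩

theorem BigO.of_isBigO {f g : I → ℝ} (h : ∀ F : Filter I, f =O[F] g) : BigO S f g :=
  bigO_iff_forSmall.2 ⟨Set.univ, S.univ_mem, fun _ _ => h _⟩

theorem BigO.map₂ {f g f' g' p q : I → ℝ} (h₁ : BigO S f g) (h₂ : BigO S f' g')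
    (h : ∀ F : Filter I, f =O[F] g → f' =O[F] g' → p =O[F] q) : BigO S p q :=
  bigO_iff_forSmall.2 <| ((bigO_iff_forSmall.1 h₁).and (bigO_iff_forSmall.1 h₂)
    (antitone_isBigO _ _) (antitone_isBigO _ _)).mono fun F hF => h F hF.1 hF.2

theorem BigO.trans {f g k : I → ℝ} (h₁ : BigO S f g) (h₂ : BigO S g k) : BigO S f k :=
  h₁.map₂ h₂ fun _ h h' => h.trans h'

theorem BigO.of_abs_le {f g k : I → ℝ} (h : ∀ ε, |f ε| ≤ |g ε|) (hg : BigO S g k) :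
    BigO S f k :=
  (BigO.of_isBigO fun F => Asymptotics.isBigO_of_le F h).trans hg

theorem isBigO_abs_add_abs {J : Type*} (F : Filter J) (f g : J → ℝ) :
    f =O[F] (fun ε => |f ε| + |g ε|) ∧ g =O[F] (fun ε => |f ε| + |g ε|) := by
  constructor <;> refine Asymptotics.IsBigO.of_norm_le fun ε => ?_ <;>
    simp

variable {B Z : Set (I → ℝ)}

theorem RM.exists_agPos (hB : IsAG S B) {f : I → ℝ} (hf : f ∈ RM S B) :
    ∃ b ∈ agPos S B, BigO S f b := by
  obtain ⟨b, hb, hfb⟩ := hf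
  obtain ⟨s, hs, hs0, hbs⟩ := hB.absAdd b hb b hb
  exact ⟨s, ⟨hs, hs0⟩, hfb.map₂ hbs fun F h h' => (h.trans (isBigO_abs_add_abs F b b).1).trans h'⟩

theorem RM.mono {f g : I → ℝ} (hf : f ∈ RM S B) (h : BigO S g f) : g ∈ RM S B := by
  obtain ⟨b, hb, hfb⟩ := hf
  exact ⟨b, hb, h.trans hfb⟩

theorem RM.add (hB : IsAG S B) {f g : I → ℝ} (hf : f ∈ RM S B) (hg : g ∈ RM S B) :
    (fun ε => f ε + g ε) ∈ RM S B := by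
  obtain ⟨b, hb, hfb⟩ := hf
  obtain ⟨c, hc, hgc⟩ := hg
  obtain ⟨s, hs, -, hbs⟩ := hB.absAdd b hb c hc
  refine ⟨s, hs, BigO.trans (hfb.map₂ hgc fun F h h' => ?_) hbs⟩
  exact (h.trans (isBigO_abs_add_abs F b c).1).add (h'.trans (isBigO_abs_add_abs F b c).2)

theorem RM.abs {f : I → ℝ} (hf : f ∈ RM S B) : (fun ε => |f ε|) ∈ RM S B :=
  RM.mono hf (BigO.of_isBigO fun F => (Asymptotics.isBigO_refl f F).abs_left)

theorem RM.mul (hB : IsAG S B) {f g : I → ℝ} (hf : f ∈ RM S B) (hg : g ∈ RM S B) :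
    (fun ε => f ε * g ε) ∈ RM S B := by
  obtain ⟨b, hb, hfb⟩ := hf
  obtain ⟨c, hc, hgc⟩ := hg
  obtain ⟨p, hp, hbc⟩ := hB.mul b hb c hc
  exact ⟨p, hp, BigO.trans (hfb.map₂ hgc fun F h h' => h.mul h') hbc⟩

theorem RM.sum (hB : IsAG S B) {ι : Type*} (s : Finset ι) {f : ι → I → ℝ}
    (hf : ∀ i ∈ s, f i ∈ RM S B) : (fun ε => ∑ i ∈ s, f i ε) ∈ RM S B := by
  classical
  induction s using Finset.induction_on with
  | empty =>
    obtain ⟨b, hb, -⟩ := hB.infinite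
    exact ⟨b, hb, BigO.of_isBigO fun _ => by simpa using Asymptotics.isBigO_zero _ _⟩
  | insert i s hi ih =>
    simp only [Finset.sum_insert hi]
    exact RM.add hB (hf i (by simp)) (ih fun j hj => hf j (by simp [hj]))

/-- The implied constant can be removed by passing to a larger element of the gauge; this matters
because that constant may depend on `a ∈ A`. -/
theorem RM.exists_eventually_abs_le (hB : IsAG S B) {f : I → ℝ} (hf : f ∈ RM S B) :
    ∃ q ∈ B, ForSmall S (fun F => ∀ᶠ ε in F, |f ε| ≤ q ε) := by
  obtain ⟨i, hi, hlim⟩ := hB.infinite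
  have hif : (fun ε => i ε * f ε) ∈ RM S B :=
    RM.mul hB ⟨i, hi, BigO.of_isBigO fun F => Asymptotics.isBigO_refl _ _⟩ hf
  obtain ⟨q, ⟨hq, hq0⟩, hO⟩ := RM.exists_agPos hB hif
  refine ⟨q, hq, ?_⟩
  refine (((bigO_iff_forSmall.1 hO).and (gtI_iff_forSmall.1 hq0) (antitone_isBigO _ _)
    (antitone_eventually _)).and hlim.forSmall_tendsto
    (fun _ _ h h' => ⟨h'.1.mono h, h'.2.filter_mono h⟩)
    (fun _ _ h h' => h'.mono_left h)).mono ?_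
  rintro F ⟨⟨hO, hpos⟩, hlim⟩
  obtain ⟨c, hc, hb⟩ := hO.exists_pos
  filter_upwards [hb.bound, hpos, hlim.eventually_ge_atTop c] with ε h₁ h₂ h₃
  rw [Real.norm_eq_abs, Real.norm_eq_abs, abs_mul, abs_of_pos h₂] at h₁
  refine le_of_mul_le_mul_left (le_trans ?_ h₁) hc
  gcongr

theorem RM.exp_mul (hB : IsAG S B) {f : I → ℝ} (hf : f ∈ RM S B) {R : ℝ} (hR : 0 < R) :
    (fun ε => Real.exp (R * f ε)) ∈ RM S (expAG B) := by
  obtain ⟨q, hq, hfq⟩ := RM.exists_eventually_abs_le hB hf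
  refine ⟨_, ⟨R, hR, q, hq, rfl⟩, bigO_iff_forSmall.2 (hfq.mono fun F hF => ?_)⟩
  refine Asymptotics.IsBigO.of_bound 1 ?_
  filter_upwards [hF] with ε hε
  rw [Real.norm_eq_abs, Real.norm_eq_abs, Real.abs_exp, Real.abs_exp, one_mul]
  gcongr
  exact (le_abs_self _).trans hε

theorem RM_subset_RM_expAG (hB : IsAG S B) : RM S B ⊆ RM S (expAG B) := by
  intro f hf
  refine RM.mono (RM.exp_mul hB (RM.abs hf) one_pos) (BigO.of_isBigO fun F => ?_)
  refine Asymptotics.IsBigO.of_norm_le fun ε => ?_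
  have := Real.add_one_le_exp |f ε|
  rw [Real.norm_eq_abs, one_mul]
  linarith

/-- The negligible nets of real numbers. -/
def NegNet (S : SetOfIndices I) (Z : Set (I → ℝ)) (f : I → ℝ) : Prop :=
  ∀ z ∈ agPos S Z, BigO S f (fun ε => (z ε)⁻¹)

theorem NegNet.of_abs_le {f g : I → ℝ} (hg : NegNet S Z g) (h : ∀ ε, |f ε| ≤ |g ε|) :
    NegNet S Z f :=
  fun z hz => (hg z hz).of_abs_le h

theorem NegNet.add {f g : I → ℝ} (hf : NegNet S Z f) (hg : NegNet S Z g) :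
    NegNet S Z (fun ε => f ε + g ε) :=
  fun z hz => (hf z hz).map₂ (hg z hz) fun _ h h' => h.add h'

theorem NegNet.sum {ι : Type*} (s : Finset ι) {f : ι → I → ℝ}
    (hf : ∀ i ∈ s, NegNet S Z (f i)) : NegNet S Z (fun ε => ∑ i ∈ s, f i ε) := by
  classical
  induction s using Finset.induction_on with
  | empty => exact fun z _ => BigO.of_isBigO fun _ => by simpa using Asymptotics.isBigO_zero _ _
  | insert i s hi ih =>
    simp only [Finset.sum_insert hi]
    exact (hf i (by simp)).add (ih fun j hj => hf j (by simp [hj]))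

theorem NegNet.mul_RM (hZ : IsAG S Z) {f g : I → ℝ} (hf : NegNet S Z f) (hg : g ∈ RM S Z) :
    NegNet S Z (fun ε => f ε * g ε) := by
  intro z hz
  have hzg : (fun ε => z ε * g ε) ∈ RM S Z :=
    RM.mul hZ ⟨z, hz.1, BigO.of_isBigO fun F => Asymptotics.isBigO_refl _ _⟩ hg
  obtain ⟨w, hw, hO⟩ := RM.exists_agPos hZ hzg
  refine bigO_iff_forSmall.2 <| (((bigO_iff_forSmall.1 (hf w hw)).and (bigO_iff_forSmall.1 hO)
    (antitone_isBigO _ _) (antitone_isBigO _ _)).and (gtI_iff_forSmall.1 hz.2)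
    (fun _ _ h h' => ⟨h'.1.mono h, h'.2.mono h⟩) (antitone_eventually _)).mono ?_
  rintro F ⟨⟨h₁, h₂⟩, hpos⟩
  have h₃ : (fun ε => (w ε)⁻¹ * w ε) =O[F] (fun _ => (1 : ℝ)) :=
    Asymptotics.IsBigO.of_norm_le fun ε => by
      by_cases h : w ε = 0 <;> simp [h]
  have h₄ := (Asymptotics.isBigO_refl (fun ε => (z ε)⁻¹) F).mul ((h₁.mul h₂).trans h₃)
  refine h₄.congr' ?_ (by simp)
  filter_upwards [hpos] with ε hε
  field_simp

end Asymptotics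

section LinearODE

theorem abs_le_supAbsOn {K : Set ℝ} (hK : IsCompact K) {f : ℝ → ℝ} (hf : Continuous f) {t : ℝ}
    (ht : t ∈ K) : |f t| ≤ supAbsOn K f :=
  le_csSup (hK.image hf.abs).bddAbove ⟨t, ht, rfl⟩

theorem supAbsOn_nonneg (K : Set ℝ) (f : ℝ → ℝ) : 0 ≤ supAbsOn K f := by
  refine Real.sSup_nonneg ?_
  rintro _ ⟨t, -, rfl⟩
  exact abs_nonneg _

theorem supAbsOn_le {K : Set ℝ} {f : ℝ → ℝ} {M : ℝ} (hM : 0 ≤ M) (h : ∀ t ∈ K, |f t| ≤ M) :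
    supAbsOn K f ≤ M := by
  refine Real.sSup_le ?_ hM
  rintro _ ⟨t, ht, rfl⟩
  exact h t ht

variable {d : ℕ}

theorem norm_le_sum_abs (v : Fin d → ℝ) : ‖v‖ ≤ ∑ i, |v i| :=
  (pi_norm_le_iff_of_nonneg (by positivity)).2 fun i =>
    Finset.single_le_sum (f := fun i => |v i|) (fun _ _ => abs_nonneg _) (Finset.mem_univ i)

theorem norm_mulVec_le_sum_abs (A : Matrix (Fin d) (Fin d) ℝ) (v : Fin d → ℝ) :
    ‖A.mulVec v‖ ≤ (∑ i, ∑ j, |A i j|) * ‖v‖ := by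
  refine (norm_le_sum_abs _).trans ?_
  rw [Finset.sum_mul]
  refine Finset.sum_le_sum fun i _ => ?_
  rw [Finset.sum_mul]
  rw [Matrix.mulVec, dotProduct]
  refine (Finset.abs_sum_le_sum_abs _ _).trans (Finset.sum_le_sum fun j _ => ?_)
  rw [abs_mul]
  gcongr
  exact norm_le_pi_norm v j

theorem norm_le_exp_of_norm_deriv_le {E : Type*} [NormedAddCommGroup E] [NormedSpace ℝ E]
    {y y' : ℝ → E} {K δ η R : ℝ} (hK : 1 ≤ K) (hη : 0 ≤ η)
    (hy : ∀ t, HasDerivAt y (y' t) t) (hy0 : ‖y 0‖ ≤ δ)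
    (hbound : ∀ t ∈ Set.Icc 0 R, ‖y' t‖ ≤ K * ‖y t‖ + η) {t : ℝ} (ht : t ∈ Set.Icc 0 R) :
    ‖y t‖ ≤ (δ + η) * Real.exp (R * K) := by
  have h := norm_le_gronwallBound_of_norm_deriv_right_le (f := y) (f' := y') (a := 0) (b := R)
    (fun s _ => (hy s).continuousAt.continuousWithinAt) (fun s _ => (hy s).hasDerivWithinAt) hy0
    (fun s hs => hbound s (Set.Ico_subset_Icc_self hs)) t ht
  have hδ : 0 ≤ δ := (norm_nonneg _).trans hy0
  rw [gronwallBound_of_K_ne_0 (by positivity), sub_zero] at h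
  have hexp : Real.exp (K * t) ≤ Real.exp (R * K) := by
    rw [mul_comm K]
    gcongr
    exact ht.2
  have h1 : 0 ≤ Real.exp (K * t) - 1 := by
    have := Real.one_le_exp (mul_nonneg (zero_le_one.trans hK) ht.1)
    linarith
  have h2 : η / K * (Real.exp (K * t) - 1) ≤ η * Real.exp (R * K) :=
    mul_le_mul (div_le_self hη hK) (by linarith) h1 hη
  have h3 : δ * Real.exp (K * t) ≤ δ * Real.exp (R * K) := by gcongr
  linarith

theorem norm_linear_ODE_le {A : Matrix (Fin d) (Fin d) ℝ} {x n : ℝ → Fin d → ℝ} {t₀ R η : ℝ}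
    (hη : 0 ≤ η) (hode : ∀ t, HasDerivAt x (n t - A.mulVec (x t)) t)
    (hn : ∀ t ∈ Metric.closedBall t₀ R, ‖n t‖ ≤ η) {t : ℝ} (ht : t ∈ Metric.closedBall t₀ R) :
    ‖x t‖ ≤ (‖x t₀‖ + η) * Real.exp (R * (1 + ∑ i, ∑ j, |A i j|)) := by
  have hA : 0 ≤ ∑ i, ∑ j, |A i j| := by positivity
  have key : ∀ σ : ℝ, |σ| = 1 → ∀ s ∈ Set.Icc 0 R,
      ‖x (t₀ + σ * s)‖ ≤ (‖x t₀‖ + η) * Real.exp (R * (1 + ∑ i, ∑ j, |A i j|)) := by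
    intro σ hσ s hs
    refine norm_le_exp_of_norm_deriv_le (y := fun s => x (t₀ + σ * s))
      (y' := fun s => σ • (n (t₀ + σ * s) - A.mulVec (x (t₀ + σ * s))))
      (by linarith) hη (fun s => ?_) (by simp) (fun s hs => ?_) hs
    · have h : HasDerivAt (fun s => t₀ + σ * s) σ s := by
        simpa using ((hasDerivAt_id s).const_mul σ).const_add t₀
      exact (hode (t₀ + σ * s)).scomp s h
    · rw [norm_smul, Real.norm_eq_abs, hσ, one_mul]
      refine (norm_sub_le _ _).trans ?_
      have h₁ := hn (t₀ + σ * s) (by simp [hσ, abs_of_nonneg hs.1, hs.2])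
      have h₂ := norm_mulVec_le_sum_abs A (x (t₀ + σ * s))
      have h₃ := norm_nonneg (x (t₀ + σ * s))
      linarith
  rw [Metric.mem_closedBall, Real.dist_eq] at ht
  rcases le_total t₀ t with h | h
  · rw [abs_of_nonneg (by linarith)] at ht
    simpa using key 1 (by simp) (t - t₀) ⟨by linarith, ht⟩
  · rw [abs_of_nonpos (by linarith)] at ht
    simpa using key (-1) (by simp) (t₀ - t) ⟨by linarith, by linarith⟩

theorem contDiff_coord {x : ℝ → Fin d → ℝ} (hx : ContDiff ℝ (⊤ : ℕ∞) x) (i : Fin d) :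
    ContDiff ℝ (⊤ : ℕ∞) (fun t => x t i) :=
  contDiff_pi.1 hx i

theorem continuous_iteratedDeriv_coord {x : ℝ → Fin d → ℝ} (hx : ContDiff ℝ (⊤ : ℕ∞) x)
    (k : ℕ) (i : Fin d) : Continuous (iteratedDeriv k (fun t => x t i)) :=
  (contDiff_coord hx i).continuous_iteratedDeriv k (by exact_mod_cast le_top)

theorem iteratedDeriv_succ_linear_ODE {A : Matrix (Fin d) (Fin d) ℝ} {x n : ℝ → Fin d → ℝ}
    (hx : ContDiff ℝ (⊤ : ℕ∞) x) (hn : ContDiff ℝ (⊤ : ℕ∞) n)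
    (hode : ∀ t, HasDerivAt x (n t - A.mulVec (x t)) t) (k : ℕ) (i : Fin d) (t : ℝ) :
    iteratedDeriv (k + 1) (fun t => x t i) t = iteratedDeriv k (fun t => n t i) t -
      ∑ j, A i j * iteratedDeriv k (fun t => x t j) t := by
  have hderiv : deriv (fun t => x t i) =
      (fun t => n t i) - fun t => ∑ j, A i j * x t j :=
    funext fun t => (hasDerivAt_pi.1 (hode t) i).deriv
  have hk : ((k : ℕ∞) : WithTop ℕ∞) ≤ ((⊤ : ℕ∞) : WithTop ℕ∞) := by exact_mod_cast le_top
  have hxk : ∀ j, ContDiffAt ℝ k (fun t => x t j) t :=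
    fun j => ((contDiff_coord hx j).of_le hk).contDiffAt
  rw [iteratedDeriv_succ', hderiv, iteratedDeriv_sub ((contDiff_coord hn i).of_le hk).contDiffAt
    (ContDiffAt.sum fun j _ => contDiffAt_const.mul (hxk j)),
    iteratedDeriv_fun_sum fun j _ => contDiffAt_const.mul (hxk j)]
  simp only [iteratedDeriv_const_mul_field]

theorem supAbsOn_iteratedDeriv_succ_le {A : Matrix (Fin d) (Fin d) ℝ} {x n : ℝ → Fin d → ℝ}
    (hx : ContDiff ℝ (⊤ : ℕ∞) x) (hn : ContDiff ℝ (⊤ : ℕ∞) n)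
    (hode : ∀ t, HasDerivAt x (n t - A.mulVec (x t)) t) {K : Set ℝ} (hK : IsCompact K)
    (k : ℕ) (i : Fin d) :
    supAbsOn K (iteratedDeriv (k + 1) (fun t => x t i)) ≤
      supAbsOn K (iteratedDeriv k (fun t => n t i)) +
        ∑ j, supAbsOn K (iteratedDeriv k (fun t => x t j)) * |A i j| := by
  refine supAbsOn_le (add_nonneg (supAbsOn_nonneg _ _) (Finset.sum_nonneg fun j _ =>
    mul_nonneg (supAbsOn_nonneg _ _) (abs_nonneg _))) fun t ht => ?_
  rw [iteratedDeriv_succ_linear_ODE hx hn hode]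
  rw [← Real.norm_eq_abs]
  refine (norm_sub_le _ _).trans (add_le_add
    (abs_le_supAbsOn hK (continuous_iteratedDeriv_coord hn k i) ht)
    ((norm_sum_le _ _).trans (Finset.sum_le_sum fun j _ => ?_)))
  rw [norm_mul, mul_comm, Real.norm_eq_abs, Real.norm_eq_abs]
  gcongr
  exact abs_le_supAbsOn hK (continuous_iteratedDeriv_coord hx k j) ht

theorem supAbsOn_linear_ODE_le {A : Matrix (Fin d) (Fin d) ℝ} {x n : ℝ → Fin d → ℝ} {t₀ R : ℝ}
    (hn : Continuous n) (hode : ∀ t, HasDerivAt x (n t - A.mulVec (x t)) t) {K : Set ℝ}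
    (hK : K ⊆ Metric.closedBall t₀ R) (i : Fin d) :
    supAbsOn K (fun t => x t i) ≤
      (∑ j, |x t₀ j| + ∑ j, supAbsOn (Metric.closedBall t₀ R) (fun t => n t j)) *
        (Real.exp R * Real.exp (R * ∑ i, ∑ j, |A i j|)) := by
  have hη : 0 ≤ ∑ j, supAbsOn (Metric.closedBall t₀ R) (fun t => n t j) :=
    Finset.sum_nonneg fun j _ => supAbsOn_nonneg _ _
  refine supAbsOn_le (by positivity) fun t ht => ?_
  refine (norm_le_pi_norm (x t) i).trans ((norm_linear_ODE_le hη hode (fun s hs => ?_)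
    (hK ht)).trans ?_)
  · exact (norm_le_sum_abs _).trans (Finset.sum_le_sum fun j _ =>
      abs_le_supAbsOn (isCompact_closedBall _ _) (continuous_pi_iff.1 hn j) hs)
  · rw [mul_add, mul_one, Real.exp_add]
    gcongr
    exact norm_le_sum_abs _

end LinearODE

/-- Uniqueness, Lem. `uniqueness` of the paper: a `𝓑'`-moderate
solution of a linear ODE with `𝓑`-bounded coefficients, `𝒵'`-negligible
right-hand side and `𝒵'`-negligible initial datum, is `𝒵'`-negligible. -/
theorem linear_ODE_uniqueness {I : Type*} [Preorder I] (S : SetOfIndices I)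
    (B B' Z' : Set (I → ℝ)) (hB : IsAG S B) (hB' : IsAG S B') (hZ' : IsAG S Z')
    (hEB : RM S (expAG B) ⊆ RM S B') (hB'Z' : RM S B' ⊆ RM S Z')
    (d : ℕ) (hd : 1 ≤ d) (t₀ : ℝ)
    (A : I → Matrix (Fin d) (Fin d) ℝ)
    (hA : ∀ i j, (fun ε => A ε i j) ∈ RM S B)
    (x nn : I → ℝ → Fin d → ℝ) (v : I → Fin d → ℝ)
    (hxs : ∀ ε, ContDiff ℝ (⊤ : ℕ∞) (x ε)) (hns : ∀ ε, ContDiff ℝ (⊤ : ℕ∞) (nn ε))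
    (hxm : ∀ i : Fin d, EM1 S B' (fun ε t => x ε t i))
    (hnneg : ∀ i : Fin d, NEG1 S Z' (fun ε t => nn ε t i))
    (hv : ∀ i : Fin d, ∀ z ∈ agPos S Z',
      BigO S (fun ε => v ε i) (fun ε => (z ε)⁻¹))
    (hode : ∀ ε t, HasDerivAt (x ε) (nn ε t - (A ε).mulVec (x ε t)) t)
    (hinit : ∀ ε, x ε t₀ = v ε) :
    ∀ i : Fin d, NEG1 S Z' (fun ε t => x ε t i) := by
  have hBZ : RM S (expAG B) ⊆ RM S Z' := hEB.trans hB'Z'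
  have hAZ : ∀ i j, (fun ε => |A ε i j|) ∈ RM S Z' := fun i j =>
    RM.abs (hBZ (RM_subset_RM_expAG hB (hA i j)))
  have hAsum : (fun ε => ∑ i, ∑ j, |A ε i j|) ∈ RM S B :=
    RM.sum hB _ fun i _ => RM.sum hB _ fun j _ => RM.abs (hA i j)
  suffices h : ∀ K : Set ℝ, IsCompact K → ∀ k : ℕ, ∀ i : Fin d,
      NegNet S Z' (fun ε => supAbsOn K (iteratedDeriv k (fun t => x ε t i))) from
    fun i K hK k => h K hK k i
  intro K hK k
  induction k with
  | zero =>
    intro i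
    obtain ⟨R, hR, hKR⟩ := hK.isBounded.subset_closedBall_lt 0 t₀
    have hexp : (fun ε => Real.exp R * Real.exp (R * ∑ i, ∑ j, |A ε i j|)) ∈ RM S Z' :=
      RM.mono (hBZ (RM.exp_mul hB hAsum hR))
        (BigO.of_isBigO fun F => Asymptotics.isBigO_const_mul_self _ _ F)
    have hdata : NegNet S Z' (fun ε => ∑ j, |x ε t₀ j| +
        ∑ j, supAbsOn (Metric.closedBall t₀ R) (fun t => nn ε t j)) := by
      refine (NegNet.sum _ fun j _ => ?_).add (NegNet.sum _ fun j _ => ?_)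
      · simp only [hinit]
        exact NegNet.of_abs_le (hv j) fun ε => by simp
      · have h := hnneg j (Metric.closedBall t₀ R) (isCompact_closedBall _ _) 0
        simp only [iteratedDeriv_zero] at h
        exact h
    refine (hdata.mul_RM hZ' hexp).of_abs_le fun ε => ?_
    rw [abs_of_nonneg (supAbsOn_nonneg _ _), iteratedDeriv_zero]
    exact (supAbsOn_linear_ODE_le (hns ε).continuous (hode ε) hKR i).trans (le_abs_self _)
  | succ k ih =>
    intro i
    have hsum : NegNet S Z' (fun ε => supAbsOn K (iteratedDeriv k (fun t => nn ε t i)) +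
        ∑ j, supAbsOn K (iteratedDeriv k (fun t => x ε t j)) * |A ε i j|) :=
      NegNet.add (hnneg i K hK k) (NegNet.sum _ fun j _ => (ih j).mul_RM hZ' (hAZ i j))
    refine hsum.of_abs_le fun ε => ?_
    rw [abs_of_nonneg (supAbsOn_nonneg _ _)]
    exact (supAbsOn_iteratedDeriv_succ_le (hxs ε) (hns ε) (hode ε) hK k i).trans (le_abs_self _)
end

section
/- Let 𝕀 = (I, ≤, 𝓘) be a set of indices and let 𝓑, 𝓑' be asymptotic gauges on 𝕀. Suppose that for every b ∈ 𝓑 the initial value problem x'(t) + b·x(t) = 0, x(0) = 1 is solvable in the Colombeau algebra generated by 𝓑', i.e. there exist a net (x_ε)_{ε∈I} of smooth functions ℝ → ℝ with (x_ε) ∈ ℰ_M(𝓑',ℝ), a net (n_ε) ∈ 𝒩(𝓑',ℝ), and a net (v_ε) ∈ ℝ^I which is 𝓑'-negligible (for every z ∈ 𝓑'_{>0}, (v_ε)_ε = O((z_ε^{-1})_ε)), such that for every ε ∈ I: x_ε'(t) + b_ε·x_ε(t) = n_ε(t) for all t ∈ ℝ and x_ε(0) = 1 + v_ε. Then ℝ_M(e^𝓑)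 ⊆ ℝ_M(𝓑'), where e^𝓑 := {(exp(H·b_ε))_ε | H > 0, b ∈ 𝓑}. (This is the key half of the theorem that 𝒢(e^𝓑,ℝ) is the smallest Colombeau algebra generated by asymptotic gauges in which every linear homogeneous ODE with coefficients in ℝ_M(𝓑) can be solved.) -/
open MeasureTheory

section Helpers

variable {I : Type*} [Preorder I]

/-- Below every point of a common index set, `P p ε` holds for all sufficiently small `ε`, for some
parameter `p` depending on that point. -/
def LocallyI {α : Type*} (S : SetOfIndices I) (P : α → I → Prop) : Prop :=
  ∃ A ∈ S.sets, ∀ a ∈ A, ∃ p, ∃ e ∈ A, e ≤ a ∧ ∀ ε ∈ A, ε ≤ e → P p ε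

theorem LocallyI.and_dep {α β : Type*} {S : SetOfIndices I} {P : α → I → Prop}
    {Q : α → β → I → Prop} (hP : LocallyI S P)
    (hQ : ∃ A ∈ S.sets, ∀ a ∈ A, ∀ p, ∃ q, ∃ e ≤ a, ∀ ε ∈ A, ε ≤ e → Q p q ε) :
    LocallyI S (fun (r : α × β) ε => P r.1 ε ∧ Q r.1 r.2 ε) := by
  obtain ⟨A, hA, hP⟩ := hP
  obtain ⟨A', hA', hQ⟩ := hQ
  obtain ⟨C, hC, hCA⟩ := S.inter_sub A hA A' hA'
  refine ⟨C, hC, fun a ha => ?_⟩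
  obtain ⟨p, e, -, hea, hp⟩ := hP a (hCA ha).1
  obtain ⟨c, hc, hce⟩ := (S.downward C hC a ha e hea).1
  obtain ⟨q, e', he'c, hq⟩ := hQ c (hCA hc).2 p
  obtain ⟨d, hd, hde'⟩ := (S.downward C hC c hc e' he'c).1
  exact ⟨(p, q), d, hd, hde'.trans (he'c.trans (hce.trans hea)), fun ε hε hεd =>
    ⟨hp ε (hCA hε).1 (hεd.trans (hde'.trans (he'c.trans hce))),
      hq ε (hCA hε).2 (hεd.trans hde')⟩⟩

theorem LocallyI.and {α β : Type*} {S : SetOfIndices I} {P : α → I → Prop} {Q : β → I → Prop}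
    (hP : LocallyI S P) (hQ : LocallyI S Q) :
    LocallyI S (fun (r : α × β) ε => P r.1 ε ∧ Q r.2 ε) := by
  obtain ⟨A, hA, hQ⟩ := hQ
  refine hP.and_dep (Q := fun _ => Q) ⟨A, hA, fun a ha _ => ?_⟩
  obtain ⟨q, e, -, hea, hq⟩ := hQ a ha
  exact ⟨q, e, hea, hq⟩

theorem LocallyI.and_limInfinite {α : Type*} {S : SetOfIndices I} {P : α → I → Prop} {f : I → ℝ}
    (hP : LocallyI S P) (hf : limInfinite S f) (R : α → ℝ) :
    LocallyI S (fun (r : α × Unit) ε => P r.1 ε ∧ R r.1 < |f ε|) := by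
  obtain ⟨A, hA, hf⟩ := hf
  refine hP.and_dep (Q := fun p _ ε => R p < |f ε|) ⟨A, hA, fun a ha p => ⟨(), ?_⟩⟩
  obtain ⟨e, hea, he⟩ := hf a ha (max (R p) 1) (by positivity)
  exact ⟨e, hea, fun ε hε hεe => (le_max_left _ _).trans_lt (he ε hε hεe)⟩

theorem LocallyI.mono {α β : Type*} {S : SetOfIndices I} {P : α → I → Prop} {Q : β → I → Prop}
    (hP : LocallyI S P) (g : α → β) (h : ∀ p ε, P p ε → Q (g p) ε) : LocallyI S Q := by
  obtain ⟨A, hA, hP⟩ := hP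
  refine ⟨A, hA, fun a ha => ?_⟩
  obtain ⟨p, e, he, hea, hp⟩ := hP a ha
  exact ⟨g p, e, he, hea, fun ε hε hεe => h p ε (hp ε hε hεe)⟩

theorem bigO_iff_locallyI {S : SetOfIndices I} {x y : I → ℝ} :
    BigO S x y ↔ LocallyI S (fun (H : ℝ) ε => 0 < H ∧ |x ε| ≤ H * |y ε|) := by
  constructor
  · rintro ⟨A, hA, h⟩
    refine ⟨A, hA, fun a ha => ?_⟩
    obtain ⟨H, hH, e, he, hea, hb⟩ := h a ha
    exact ⟨H, e, he, hea, fun ε hε hεe => ⟨hH, hb ε hε hεe⟩⟩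
  · rintro ⟨A, hA, h⟩
    refine ⟨A, hA, fun a ha => ?_⟩
    obtain ⟨H, e, he, hea, hb⟩ := h a ha
    exact ⟨H, (hb e he le_rfl).1, e, he, hea, fun ε hε hεe => (hb ε hε hεe).2⟩

/-- A negligible net is eventually smaller than any positive constant. -/
theorem locallyI_abs_lt_of_negligible {S : SetOfIndices I} {B : Set (I → ℝ)} (hB : IsAG S B)
    {v : I → ℝ} (hv : ∀ z ∈ agPos S B, BigO S v (fun ε => (z ε)⁻¹)) {r : ℝ} (hr : 0 < r) :
    LocallyI S (fun (_ : Unit) ε => |v ε| < r) := by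
  obtain ⟨i, hi, hlim⟩ := hB.infinite
  obtain ⟨s, hs, hs0, hsO⟩ := hB.absAdd i hi i hi
  have h := ((bigO_iff_locallyI.1 hsO).and (bigO_iff_locallyI.1 (hv s ⟨hs, hs0⟩))).and_limInfinite
    hlim (fun p => p.1 * p.2 / r)
  refine h.mono (fun _ => ()) ?_
  rintro ⟨⟨H, K⟩, _⟩ ε ⟨⟨⟨hH, hi⟩, hK, hv⟩, hR⟩
  dsimp only at *
  rw [abs_of_nonneg (by positivity)] at hi
  rw [div_lt_iff₀ hr] at hR
  have hKs : K < |s ε| * r := by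
    have : H * K < H * (|s ε| * r) := by nlinarith [mul_nonneg (abs_nonneg (i ε)) hr.le]
    exact lt_of_mul_lt_mul_left this hH.le
  have hspos : 0 < |s ε| := pos_of_mul_pos_left (hK.trans hKs) hr.le
  refine hv.trans_lt ?_
  rw [abs_inv, ← div_eq_mul_inv, div_lt_iff₀ hspos]
  linarith

end Helpers

/-- A solution of `x' + b x = n` with `x 0` close to `1` and `n` small grows backwards in time at
least like `exp (-b t)`. -/
theorem exp_le_of_perturbed_linear_ode {x n : ℝ → ℝ} {b h M : ℝ} (hh : 0 < h)
    (hx : ∀ t, HasDerivAt x (n t - b * x t) t) (hn : ∀ t ∈ Set.Icc (-h) 0, |n t| ≤ M)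
    (hM : M * h ≤ 1 / 4) (hx0 : |x 0 - 1| ≤ 1 / 4) :
    Real.exp (h * b) ≤ 1 + 2 * |x (-h)| := by
  rcases le_total b 0 with hb | hb
  · have : Real.exp (h * b) ≤ 1 := Real.exp_le_one_iff.2 (mul_nonpos_of_nonneg_of_nonpos hh.le hb)
    linarith [abs_nonneg (x (-h))]
  have hd : ∀ t, HasDerivAt (fun t => Real.exp (b * t) * x t) (Real.exp (b * t) * n t) t := by
    intro t
    have h1 : HasDerivAt (fun t => Real.exp (b * t)) (Real.exp (b * t) * b) t := by
      simpa using ((hasDerivAt_id t).const_mul b).exp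
    exact (h1.mul (hx t)).congr_deriv (by ring)
  have hle : ‖Real.exp (b * 0) * x 0 - Real.exp (b * -h) * x (-h)‖ ≤ M * (0 - -h) := by
    refine norm_image_sub_le_of_norm_deriv_le_segment'
      (f := fun t => Real.exp (b * t) * x t) (fun t _ => (hd t).hasDerivWithinAt)
      (fun t ht => ?_) 0 (Set.right_mem_Icc.2 (by linarith))
    rw [norm_mul, Real.norm_eq_abs, Real.abs_exp, Real.norm_eq_abs]
    have : Real.exp (b * t) ≤ 1 := Real.exp_le_one_iff.2 (mul_nonpos_of_nonneg_of_nonpos hb ht.2.le)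
    have := hn t ⟨ht.1, ht.2.le⟩
    nlinarith [abs_nonneg (n t)]
  rw [mul_zero, Real.exp_zero, one_mul, Real.norm_eq_abs] at hle
  have h1 := (abs_le.1 hle).2
  have h2 := (abs_le.1 hx0).1
  have h3 : 1 / 2 ≤ Real.exp (b * -h) * |x (-h)| := by
    nlinarith [le_abs_self (x (-h)), Real.exp_pos (b * -h)]
  have h4 : Real.exp (h * b) * Real.exp (b * -h) = 1 := by
    rw [← Real.exp_add, ← Real.exp_zero]; congr 1; ring
  have h5 := mul_le_mul_of_nonneg_left h3 (Real.exp_pos (h * b)).le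
  rw [← mul_assoc, h4] at h5
  linarith

/-- minimality half of Thm. `expB-smallest` of the paper: if every
problem `x' + b·x = 0`, `x(0) = 1` with `b ∈ 𝓑` is solvable in the Colombeau
algebra generated by `𝓑'`, then `ℝ_M(e^𝓑) ⊆ ℝ_M(𝓑')`. -/
theorem expAG_smallest {I : Type*} [Preorder I] (S : SetOfIndices I)
    (B B' : Set (I → ℝ)) (hB : IsAG S B) (hB' : IsAG S B')
    (hsolve : ∀ b ∈ B, ∃ x : I → ℝ → ℝ, ∃ nn : I → ℝ → ℝ, ∃ v : I → ℝ,
      (∀ ε, ContDiff ℝ (⊤ : ℕ∞) (x ε)) ∧ (∀ ε, ContDiff ℝ (⊤ : ℕ∞) (nn ε)) ∧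
      EM1 S B' x ∧ NEG1 S B' nn ∧
      (∀ z ∈ agPos S B', BigO S v (fun ε => (z ε)⁻¹)) ∧
      (∀ ε : I, ∀ t : ℝ, HasDerivAt (x ε) (nn ε t - b ε * x ε t) t) ∧
      (∀ ε : I, x ε 0 = 1 + v ε)) :
    RM S (expAG B) ⊆ RM S B' := by
  rintro y ⟨_, ⟨h, hh, b, hb, rfl⟩, hy⟩
  obtain ⟨x, n, v, hxs, hns, hxM, hnN, hv, hode, hx0⟩ := hsolve b hb
  have hn : ∀ z ∈ agPos S B',
      BigO S (fun ε => supAbsOn (Set.Icc (-h) 0) (n ε)) (fun ε => (z ε)⁻¹) := by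
    simpa only [iteratedDeriv_zero] using hnN (Set.Icc (-h) 0) isCompact_Icc 0
  obtain ⟨c, hc, hxc⟩ := hxM (Set.Icc (-h) 0) isCompact_Icc 0
  simp only [iteratedDeriv_zero] at hxc
  obtain ⟨i, hi, hlim⟩ := hB'.infinite
  obtain ⟨s, hs, -, hsO⟩ := hB'.absAdd i hi c hc
  have hr : 0 < 1 / (4 * h) := by positivity
  refine ⟨s, hs, bigO_iff_locallyI.2 ?_⟩
  have key := (((((bigO_iff_locallyI.1 hy).and (bigO_iff_locallyI.1 hxc)).and
    (bigO_iff_locallyI.1 hsO)).and (locallyI_abs_lt_of_negligible hB' hn hr)).and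
    (locallyI_abs_lt_of_negligible hB' hv (r := 1 / 4) (by norm_num))).and_limInfinite hlim
    (fun _ => 1)
  refine key.mono (fun p => p.1.1.1.1.1 * ((1 + 2 * p.1.1.1.1.2) * p.1.1.1.2)) ?_
  rintro ⟨⟨⟨⟨⟨Y, X⟩, T⟩, _⟩, _⟩, _⟩ ε ⟨⟨⟨⟨⟨⟨hY, hy⟩, hX, hx⟩, hT, hst⟩, hn⟩, hv⟩, hi⟩
  dsimp only at *
  refine ⟨by positivity, ?_⟩
  rw [Real.abs_exp] at hy
  rw [abs_of_nonneg (by positivity)] at hst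
  have hexp : Real.exp (h * b ε) ≤ 1 + 2 * |x ε (-h)| := by
    refine exp_le_of_perturbed_linear_ode hh (hode ε)
      (fun t ht => abs_le_supAbsOn isCompact_Icc (hns ε).continuous ht) ?_ ?_
    · have h1 := (le_abs_self _).trans hn.le
      calc _ ≤ 1 / (4 * h) * h := mul_le_mul_of_nonneg_right h1 hh.le
        _ = 1 / 4 := by field_simp
    · rw [hx0, add_sub_cancel_left]
      exact hv.le
  have hxh : |x ε (-h)| ≤ X * |c ε| :=
    (abs_le_supAbsOn isCompact_Icc (hxs ε).continuous
      (Set.left_mem_Icc.2 (by linarith))).trans ((le_abs_self _).trans hx)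
  have hbound : Real.exp (h * b ε) ≤ (1 + 2 * X) * (T * |s ε|) :=
    calc Real.exp (h * b ε) ≤ (1 + 2 * X) * (|i ε| + |c ε|) := by
          nlinarith [mul_nonneg hX.le (abs_nonneg (i ε)), abs_nonneg (c ε)]
      _ ≤ _ := mul_le_mul_of_nonneg_left hst (by positivity)
  calc |y ε| ≤ Y * Real.exp (h * b ε) := hy
    _ ≤ Y * ((1 + 2 * X) * (T * |s ε|)) := mul_le_mul_of_nonneg_left hbound hY.le
    _ = _ := by ring
end
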